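/- Let C = A_N + W be a corner-modified BBT transformation of V_{L,R}, where A_N = P_{L,R} 𝐀 |_{V_{L,R}} with 𝐀 a BBL transformation of bandwidth (p,q) and W a corner modification for bandwidth (p,q). Then for every integer κ ≥ 1 with 2(R − L) > κ(q − p), the power C^κ = A_N^{(κ)} + W_κ is a corner-modified BBT transformation, where A_N^{(κ)} = P_{L,R} 𝐀^κ |_{V_{L,R}} and W_κ is a corner modification for bandwidth (κp, κq), i.e. P_B^{(κp,κq)}(C^κ − P_{L,R} 𝐀^κ |_{V_{L,R}}) = 0. -/

import Mathlib

noncomputable section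

/-- The space of doubly-infinite sequences with values in `ℂ^d`. -/
abbrev SeqSp (d : ℕ) : Type := ℤ → Fin d → ℂ

/-- The shift `(Ψ_j)_j ↦ (Ψ_{j+n})_j`; for `n = 1` this is the left shift `T`. -/
def shiftBy (d : ℕ) (n : ℤ) : Module.End ℂ (SeqSp d) where
  toFun Ψ := fun j => Ψ (j + n)
  map_add' _ _ := rfl
  map_smul' _ _ := rfl

/-- Entrywise multiplication of a sequence by a fixed `d × d` matrix. -/
def matOp (d : ℕ) (m : Matrix (Fin d) (Fin d) ℂ) : Module.End ℂ (SeqSp d) where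
  toFun Ψ := fun j => m.mulVec (Ψ j)
  map_add' Ψ Φ := by funext j; simp [Matrix.mulVec_add]
  map_smul' c Ψ := by funext j; simp [Matrix.mulVec_smul]

/-- The banded block-Laurent (BBL) transformation `(𝐀Ψ)_j = ∑_{r=p}^{q} a_r ψ_{j+r}`. -/
def bbl (d : ℕ) (a : ℤ → Matrix (Fin d) (Fin d) ℂ) (p q : ℤ) : Module.End ℂ (SeqSp d) :=
  ∑ r ∈ Finset.Icc p q, matOp d (a r) * shiftBy d r

/-- The projection `P_S` replacing every entry with index outside `S` by zero. -/
def projOn (d : ℕ) (S : Set ℤ) : Module.End ℂ (SeqSp d) where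
  toFun Ψ := fun j => S.indicator Ψ j
  map_add' Ψ Φ := by
    funext j
    by_cases h : j ∈ S <;> simp [Set.indicator_apply, h]
  map_smul' c Ψ := by
    funext j
    by_cases h : j ∈ S <;> simp [Set.indicator_apply, h]

/-- The window `{j : ℤ | Lb ≤ j ≤ Rb}`, with possibly infinite endpoints. -/
def windowSet (Lb : WithBot ℤ) (Rb : WithTop ℤ) : Set ℤ :=
  {j : ℤ | Lb ≤ (j : WithBot ℤ) ∧ (j : WithTop ℤ) ≤ Rb}

/-- Sequences supported in `S` (vanishing at every index outside `S`): the space `V_{L,R}`. -/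
def suppIn (d : ℕ) (S : Set ℤ) : Submodule ℂ (SeqSp d) where
  carrier := {Ψ | ∀ j ∉ S, Ψ j = 0}
  add_mem' := by
    intro Ψ Φ hΨ hΦ j hj
    simp [Pi.add_apply, hΨ j hj, hΦ j hj]
  zero_mem' := fun j _ => rfl
  smul_mem' := by
    intro c Ψ hΨ j hj
    simp [Pi.smul_apply, hΨ j hj]

/-- Sequences vanishing at every index of `S`. -/
def vanishOn (d : ℕ) (S : Set ℤ) : Submodule ℂ (SeqSp d) where
  carrier := {Ψ | ∀ j ∈ S, Ψ j = 0}
  add_mem' := by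
    intro Ψ Φ hΨ hΦ j hj
    simp [Pi.add_apply, hΨ j hj, hΦ j hj]
  zero_mem' := fun j _ => rfl
  smul_mem' := by
    intro c Ψ hΨ j hj
    simp [Pi.smul_apply, hΨ j hj]

/-- The bulk solution space `M_{Lb,Rb} = Ker (P_{Lb−p',Rb−q'} 𝐀 |_{V_{Lb,Rb}})`, viewed as a
submodule of the full sequence space: sequences supported in the window `[Lb,Rb]` whose image
under `𝐀` vanishes on the bulk window `[Lb−p', Rb−q']` (with `p' = min p 0`, `q' = max q 0`). -/
def bulkSol (d : ℕ) (a : ℤ → Matrix (Fin d) (Fin d) ℂ) (p q : ℤ)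
    (Lb : WithBot ℤ) (Rb : WithTop ℤ) : Submodule ℂ (SeqSp d) :=
  suppIn d (windowSet Lb Rb) ⊓
    (vanishOn d (windowSet (Lb + ((-min p 0 : ℤ) : WithBot ℤ))
        (Rb + ((-max q 0 : ℤ) : WithTop ℤ)))).comap (bbl d a p q)

/-- Falling-factorial type product `j^{(v)} = (j−v+1)(j−v+2)⋯j`. -/
def ff (j : ℤ) (v : ℕ) : ℤ := ∏ i ∈ Finset.range v, (j - i)

/-- The scalar sequence `Φ_{z,v}`, with `j`-th entry `j^{(v−1)} z^{j−v+1}`, and `Φ_{z,0} = 0`. -/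
def Phi (z : ℂ) (v : ℕ) : ℤ → ℂ :=
  fun j => if v = 0 then 0 else (ff j (v - 1) : ℂ) * z ^ (j - (v : ℤ) + 1)

/-- The vector sequence `Φ_{z,v}|m⟩`. -/
def PhiVec (d : ℕ) (z : ℂ) (v : ℕ) (m : Fin d) : SeqSp d :=
  fun j => Phi z v j • (Pi.single m 1 : Fin d → ℂ)

/-- The subspace `T_{z,s} = Span{Φ_{z,v}|m⟩ : 1 ≤ v ≤ s, 1 ≤ m ≤ d}`. -/
def Tspace (d : ℕ) (z : ℂ) (s : ℕ) : Submodule ℂ (SeqSp d) :=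
  Submodule.span ℂ {Ψ : SeqSp d | ∃ v ∈ Finset.Icc 1 s, ∃ m : Fin d, Ψ = PhiVec d z v m}

/-- The symbol `A(w,w⁻¹) = ∑_{r=p}^q w^r a_r` as a matrix of Laurent polynomials. -/
def symbol (d : ℕ) (a : ℤ → Matrix (Fin d) (Fin d) ℂ) (p q : ℤ) :
    Matrix (Fin d) (Fin d) (LaurentPolynomial ℂ) :=
  ∑ r ∈ Finset.Icc p q, (LaurentPolynomial.T r : LaurentPolynomial ℂ) • (a r).map (fun c => LaurentPolynomial.C c)

/-- The evaluation `A(z,z⁻¹) = ∑_{r=p}^q z^r a_r` of the symbol at `z ≠ 0`. -/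
def symbolEval (d : ℕ) (a : ℤ → Matrix (Fin d) (Fin d) ℂ) (p q : ℤ) (z : ℂ) :
    Matrix (Fin d) (Fin d) ℂ :=
  ∑ r ∈ Finset.Icc p q, z ^ r • a r

/-- The `k`-th derivative `A^{(k)}(z,z⁻¹) = ∑_{r=p}^q r(r−1)⋯(r−k+1) z^{r−k} a_r`. -/
def symbolDeriv (d : ℕ) (a : ℤ → Matrix (Fin d) (Fin d) ℂ) (p q : ℤ) (k : ℕ) (z : ℂ) :
    Matrix (Fin d) (Fin d) ℂ :=
  ∑ r ∈ Finset.Icc p q, ((ff r k : ℂ) * z ^ (r - (k : ℤ))) • a r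

/-- The generalized kernel `⋃_k Ker (f^k)` of an endomorphism. -/
def genKer (d : ℕ) (f : Module.End ℂ (SeqSp d)) : Submodule ℂ (SeqSp d) :=
  ⨆ k : ℕ, LinearMap.ker (f ^ k)

/-- `F_L^− `: the generalized kernel of the unilateral shift `P_{L,∞}T` on `M_{L,∞}`. -/
def Fminus (d : ℕ) (a : ℤ → Matrix (Fin d) (Fin d) ℂ) (p q : ℤ) (L : ℤ) :
    Submodule ℂ (SeqSp d) :=
  bulkSol d a p q (L : WithBot ℤ) ⊤ ⊓
    genKer d (projOn d (windowSet (L : WithBot ℤ) ⊤) * shiftBy d 1)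

/-- `F_R^+`: the generalized kernel of the shift `P_{−∞,R}T⁻¹` on `M_{−∞,R}`. -/
def Fplus (d : ℕ) (a : ℤ → Matrix (Fin d) (Fin d) ℂ) (p q : ℤ) (R : ℤ) :
    Submodule ℂ (SeqSp d) :=
  bulkSol d a p q ⊥ (R : WithTop ℤ) ⊓
    genKer d (projOn d (windowSet ⊥ (R : WithTop ℤ)) * shiftBy d (-1))

/-- The left shift on scalar sequences. -/
def shiftS : Module.End ℂ (ℤ → ℂ) where
  toFun φ := fun j => φ (j + 1)
  map_add' _ _ := rfl
  map_smul' _ _ := rfl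

/-- The linear map on `SeqSp d` induced by a diagonal matrix polynomial with diagonal entries
`g m`: it acts on the `m`-th component of a sequence as `g m` evaluated at the left shift. -/
def diagPolyOp (d : ℕ) (g : Fin d → Polynomial ℂ) : Module.End ℂ (SeqSp d) where
  toFun Ψ := fun j m => Polynomial.aeval shiftS (g m) (fun i => Ψ i m) j
  map_add' Ψ Φ := by
    funext j m
    show Polynomial.aeval shiftS (g m) ((fun i => Ψ i m) + (fun i => Φ i m)) j = _
    rw [map_add]
    rfl
  map_smul' c Ψ := by
    funext j m
    show Polynomial.aeval shiftS (g m) (c • (fun i => Ψ i m)) j = _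
    rw [map_smul]
    rfl

/-- The subspace of sequences with values in `Span{|m⟩ : d₀ < m ≤ d}` (the range of `ρ_d(π)`). -/
def piRange (d d₀ : ℕ) : Submodule ℂ (SeqSp d) where
  carrier := {Ψ | ∀ j : ℤ, ∀ m : Fin d, (m : ℕ) < d₀ → Ψ j m = 0}
  add_mem' := by
    intro Ψ Φ hΨ hΦ j m hm
    simp [Pi.add_apply, hΨ j m hm, hΦ j m hm]
  zero_mem' := fun j m _ => rfl
  smul_mem' := by
    intro c Ψ hΨ j m hm
    simp [Pi.smul_apply, hΨ j m hm]

/-- The Hilbert space `H` of square-summable half-infinite sequences, as a subspace of `SeqSp d`: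
sequences vanishing at indices `j ≤ 0` whose restriction to `j ≥ 1` is in `ℓ²`. -/
def Hspace (d : ℕ) : Submodule ℂ (SeqSp d) where
  carrier := {Ψ | (∀ j : ℤ, j ≤ 0 → Ψ j = 0) ∧ Memℓp (fun n : ℕ => Ψ ((n : ℤ) + 1)) 2}
  add_mem' := by
    intro Ψ Φ hΨ hΦ
    refine ⟨fun j hj => by simp [Pi.add_apply, hΨ.1 j hj, hΦ.1 j hj], ?_⟩
    exact hΨ.2.add hΦ.2
  zero_mem' := ⟨fun j _ => rfl, zero_memℓp⟩
  smul_mem' := by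
    intro c Ψ hΨ
    exact ⟨fun j hj => by simp [Pi.smul_apply, hΨ.1 j hj], hΨ.2.const_smul c⟩


theorem mem_windowSet_coe {L R j : ℤ} :
    j ∈ windowSet (L : WithBot ℤ) (R : WithTop ℤ) ↔ L ≤ j ∧ j ≤ R := by
  simp [windowSet]

theorem projOn_apply_of_mem {d : ℕ} {S : Set ℤ} {j : ℤ} (h : j ∈ S) (Ψ : SeqSp d) :
    projOn d S Ψ j = Ψ j :=
  Set.indicator_of_mem h Ψ

theorem projOn_mul_eq_zero_iff {d : ℕ} {S : Set ℤ} {F : Module.End ℂ (SeqSp d)} :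
    projOn d S * F = 0 ↔ ∀ Ψ, ∀ j ∈ S, F Ψ j = 0 := by
  constructor
  · intro h Ψ j hj
    rw [← projOn_apply_of_mem hj (F Ψ)]
    exact congrFun (LinearMap.congr_fun h Ψ) j
  · intro h
    ext1 Ψ
    funext j
    exact Set.indicator_apply_eq_zero.2 (h Ψ j)

theorem bbl_apply (d : ℕ) (a : ℤ → Matrix (Fin d) (Fin d) ℂ) (p q : ℤ) (Ψ : SeqSp d) (j : ℤ) :
    bbl d a p q Ψ j = ∑ r ∈ Finset.Icc p q, (a r).mulVec (Ψ (j + r)) := by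
  simp only [bbl, LinearMap.sum_apply, Finset.sum_apply]
  rfl

/-- Entries of a banded transform at `j` only depend on the entries in `[j + p, j + q]`. -/
theorem bbl_apply_congr {d : ℕ} (a : ℤ → Matrix (Fin d) (Fin d) ℂ) {p q j : ℤ} {Ψ Φ : SeqSp d}
    (h : ∀ i, j + p ≤ i → i ≤ j + q → Ψ i = Φ i) : bbl d a p q Ψ j = bbl d a p q Φ j := by
  rw [bbl_apply, bbl_apply]
  refine Finset.sum_congr rfl fun r hr => ?_
  rw [Finset.mem_Icc] at hr
  rw [h (j + r) (by lia) (by lia)]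

/-- In the bulk for bandwidth `(k p, k q)`, the `k`-th power of a corner-modified banded block
Toeplitz transformation agrees with the `k`-th power of the Laurent transformation. -/
theorem corner_modified_pow_apply {d : ℕ} (a : ℤ → Matrix (Fin d) (Fin d) ℂ) {p q L R : ℤ}
    {W : Module.End ℂ (SeqSp d)}
    (hW : ∀ Ψ, ∀ j, L - min p 0 ≤ j → j ≤ R - max q 0 → W Ψ j = 0) (Ψ : SeqSp d) (k : ℕ) :
    ∀ j, L - k * min p 0 ≤ j → j ≤ R - k * max q 0 →
      ((projOn d (windowSet (L : WithBot ℤ) (R : WithTop ℤ)) * bbl d a p q *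
          projOn d (windowSet (L : WithBot ℤ) (R : WithTop ℤ)) + W) ^ k) Ψ j =
        (bbl d a p q ^ k) (projOn d (windowSet (L : WithBot ℤ) (R : WithTop ℤ)) Ψ) j := by
  induction k with
  | zero =>
    intro j hL hR
    simp only [pow_zero, Module.End.one_apply]
    exact (projOn_apply_of_mem (mem_windowSet_coe.2 ⟨by simpa using hL, by simpa using hR⟩) _).symm
  | succ k ih =>
    intro j hL hR
    have hp : (k : ℤ) * min p 0 ≤ 0 :=
      mul_nonpos_of_nonneg_of_nonpos k.cast_nonneg (min_le_right _ _)
    have hq : 0 ≤ (k : ℤ) * max q 0 := mul_nonneg k.cast_nonneg (le_max_right _ _)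
    push_cast at hL hR
    rw [add_one_mul] at hL hR
    have hp0 := min_le_right p 0
    have hpp := min_le_left p 0
    have hq0 := le_max_right q 0
    have hqq := le_max_left q 0
    rw [pow_succ', pow_succ', Module.End.mul_apply, Module.End.mul_apply, LinearMap.add_apply,
      Pi.add_apply, hW _ j (by linarith) (by linarith), add_zero, Module.End.mul_apply,
      Module.End.mul_apply,
      projOn_apply_of_mem (mem_windowSet_coe.2 ⟨by linarith, by linarith⟩)]
    refine bbl_apply_congr a fun i hi hi' => ?_
    rw [projOn_apply_of_mem (mem_windowSet_coe.2 ⟨by linarith, by linarith⟩)]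
    exact ih i (by linarith) (by linarith)

theorem stmt_16 (d : ℕ) (hd : 1 ≤ d) (p q : ℤ) (hpq : p ≤ q)
    (a : ℤ → Matrix (Fin d) (Fin d) ℂ) (hap : a p ≠ 0) (haq : a q ≠ 0)
    (L R : ℤ) (W : Module.End ℂ (SeqSp d))
    (hWsupp : projOn d (windowSet (L : WithBot ℤ) (R : WithTop ℤ)) * W *
        projOn d (windowSet (L : WithBot ℤ) (R : WithTop ℤ)) = W)
    (hW : projOn d (windowSet ((L - min p 0 : ℤ) : WithBot ℤ)
        ((R - max q 0 : ℤ) : WithTop ℤ)) * W = 0)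
    (κ : ℕ) (hκ : 1 ≤ κ) (hband : (κ : ℤ) * (q - p) < 2 * (R - L)) :
    projOn d (windowSet ((L - min ((κ : ℤ) * p) 0 : ℤ) : WithBot ℤ)
        ((R - max ((κ : ℤ) * q) 0 : ℤ) : WithTop ℤ)) *
      ((projOn d (windowSet (L : WithBot ℤ) (R : WithTop ℤ)) * bbl d a p q *
            projOn d (windowSet (L : WithBot ℤ) (R : WithTop ℤ)) + W) ^ κ
        - projOn d (windowSet (L : WithBot ℤ) (R : WithTop ℤ)) * (bbl d a p q) ^ κ *
            projOn d (windowSet (L : WithBot ℤ) (R : WithTop ℤ))) = 0 := by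
  rw [projOn_mul_eq_zero_iff] at hW ⊢
  have hκ0 : (0 : ℤ) ≤ κ := κ.cast_nonneg
  have hmin : min ((κ : ℤ) * p) 0 = κ * min p 0 := by rw [mul_min_of_nonneg _ _ hκ0, mul_zero]
  have hmax : max ((κ : ℤ) * q) 0 = κ * max q 0 := by rw [mul_max_of_nonneg _ _ hκ0, mul_zero]
  intro Ψ j hj
  rw [mem_windowSet_coe, hmin, hmax] at hj
  have hp : (κ : ℤ) * min p 0 ≤ 0 :=
    mul_nonpos_of_nonneg_of_nonpos hκ0 (min_le_right _ _)
  have hq : 0 ≤ (κ : ℤ) * max q 0 := mul_nonneg hκ0 (le_max_right _ _)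
  rw [LinearMap.sub_apply, Pi.sub_apply, Module.End.mul_apply (projOn d _ * _),
    Module.End.mul_apply,
    projOn_apply_of_mem (mem_windowSet_coe.2 ⟨by linarith, by linarith⟩), sub_eq_zero]
  exact corner_modified_pow_apply a (fun Φ i h h' => hW Φ i (mem_windowSet_coe.2 ⟨h, h'⟩)) Ψ κ j
    hj.1 hj.2

end
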